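/- Suppose the HNN-extension 𝔼 = ⟨B, t; t⁻¹Ht = K, φ⟩ satisfies condition (*) and 𝒞 is a class of groups closed under taking subgroups and quotient groups. If there exists a homomorphism σ of 𝔼 onto a group from 𝒞 acting injectively on H and on K, then 𝔘 ∈ 𝒞 and 𝔙 ∈ 𝒞. -/

import Mathlib

universe u

open Subgroup

/-- A class of groups in universe `u`: a property of groups. -/
abbrev GroupClass : Type (u + 1) := (G : Type u) → [inst : Group G] → Prop

/-- The class is closed under isomorphism. -/
def IsoClosed (C : GroupClass.{u}) : Prop :=
  ∀ (G₁ G₂ : Type u) [Group G₁] [Group G₂], (G₁ ≃* G₂) → C G₁ → C G₂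

/-- The class is closed under taking subgroups. -/
def SubgroupClosed (C : GroupClass.{u}) : Prop :=
  ∀ (G : Type u) [Group G] (H : Subgroup G), C G → C H

/-- The class is closed under taking quotient groups. -/
def QuotClosed (C : GroupClass.{u}) : Prop :=
  ∀ (G : Type u) [Group G] (N : Subgroup G) [N.Normal], C G → C (G ⧸ N)

/-- The class is closed under direct products of a finite number of factors. -/
def FinProdClosed (C : GroupClass.{u}) : Prop :=
  ∀ (ι : Type u) [Finite ι] (G : ι → Type u) [∀ i, Group (G i)],
    (∀ i, C (G i)) → C (∀ i, G i)

/-- Gruenberg's condition. -/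
def Gruenberg (C : GroupClass.{u}) : Prop :=
  ∀ (X : Type u) [Group X] (Y Z : Subgroup X) (_ : Z ≤ Y) (hY : Y.Normal)
    (hZY : (Z.subgroupOf Y).Normal), C (X ⧸ Y) → C (↥Y ⧸ Z.subgroupOf Y) →
    ∃ T : Subgroup X, ∃ _ : T.Normal, T ≤ Z ∧ C (X ⧸ T)

/-- A root class of groups. -/
def IsRootClass (C : GroupClass.{u}) : Prop :=
  IsoClosed C ∧ (∃ (G : Type u) (_ : Group G), C G ∧ Nontrivial G) ∧
    SubgroupClosed C ∧ Gruenberg C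

/-- `X` is residually a `C`-group. -/
def Residually (C : GroupClass.{u}) (X : Type u) [Group X] : Prop :=
  ∀ x : X, x ≠ 1 → ∃ (G : Type u) (_ : Group G) (f : X →* G),
    Function.Surjective f ∧ C G ∧ f x ≠ 1

/-- Every element has finite order. -/
def Periodic (G : Type u) [Group G] : Prop := ∀ g : G, IsOfFinOrder g

/-- The class consists only of periodic groups. -/
def PeriodicClass (C : GroupClass.{u}) : Prop := ∀ (G : Type u) [Group G], C G → Periodic G

/-- `Aut_X(Y)`: the subgroup of `Aut(Y)` consisting of the restrictions to `Y`
of the inner automorphisms of `X` (that leave `Y` invariant; when `Y` is normal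
in `X` these are the restrictions of all inner automorphisms of `X`). -/
def autOf (X : Type u) [Group X] (Y : Subgroup X) : Subgroup (MulAut Y) where
  carrier := { α | ∃ x : X, ∀ y : Y, ((α y : Y) : X) = x * y * x⁻¹ }
  one_mem' := ⟨1, fun y => by simp⟩
  mul_mem' := by
    rintro α β ⟨a, ha⟩ ⟨b, hb⟩
    refine ⟨a * b, fun y => ?_⟩
    have h1 : ((α (β y) : Y) : X) = a * (β y) * a⁻¹ := ha (β y)
    have h2 : ((β y : Y) : X) = b * y * b⁻¹ := hb y
    show ((α (β y) : Y) : X) = _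
    rw [h1, h2]; group
  inv_mem' := by
    rintro α ⟨a, ha⟩
    refine ⟨a⁻¹, fun y => ?_⟩
    have h : ((α (α⁻¹ y) : Y) : X) = a * (α⁻¹ y) * a⁻¹ := ha (α⁻¹ y)
    rw [MulAut.apply_inv_self] at h
    rw [h]; group

/-- Conjugation of automorphism groups along an isomorphism `φ : H ≃* K`,
giving `φ ∘ α ∘ φ⁻¹ : Aut K →* Aut H`. -/
def autConjHom {H K : Type u} [Group H] [Group K] (φ : H ≃* K) : MulAut K →* MulAut H where
  toFun α := (φ.trans α).trans φ.symm
  map_one' := by ext x; simp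
  map_mul' := fun α β => by
    ext x
    simp [MulAut.mul_apply, MulEquiv.trans_apply, MulEquiv.apply_symm_apply]

/-- `N ∈ 𝒞*(X)`: `N` is normal in `X` and `X/N ∈ 𝒞`. -/
def inCStar (C : GroupClass.{u}) (X : Type u) [Group X] (N : Subgroup X) : Prop :=
  ∃ _ : N.Normal, C (X ⧸ N)

/-- `X` is `𝒞`-quasi-regular with respect to its subgroup `Y`. -/
def QuasiRegular (C : GroupClass.{u}) (X : Type u) [Group X] (Y : Subgroup X) : Prop :=
  ∀ M : Subgroup Y, inCStar C Y M → ∃ N : Subgroup X, inCStar C X N ∧ N.subgroupOf Y ≤ M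

/-- `𝔓(𝒞)`: the set of primes dividing the order of some element of some `𝒞`-group. -/
def primesOf (C : GroupClass.{u}) : Set ℕ :=
  { p | p.Prime ∧ ∃ (Z : Type u) (_ : Group Z), C Z ∧ ∃ z : Z, p ∣ orderOf z }

/-- `Y` is `𝔓(𝒞)′`-isolated in `X`. -/
def PIsolated (C : GroupClass.{u}) {X : Type u} [Group X] (Y : Subgroup X) : Prop :=
  ∀ (x : X) (q : ℕ), q.Prime → q ∉ primesOf C → x ^ q ∈ Y → x ∈ Y

/-- Every finitely generated subgroup is cyclic. -/
def LocallyCyclic (G : Type u) [Group G] : Prop :=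
  ∀ S : Subgroup G, S.FG → IsCyclic S

/-- `A` is a `𝒞`-bounded abelian group. -/
def CBoundedAbelian (C : GroupClass.{u}) (A : Type u) [Group A] : Prop :=
  (∀ a b : A, a * b = b * a) ∧
  ∀ (N : Subgroup A), ∀ _ : N.Normal, ∀ p ∈ primesOf C,
    (∃ m : ℕ, 0 < m ∧ ∀ x : A ⧸ N, (∃ n : ℕ, x ^ p ^ n = 1) → x ^ m = 1) ∧
    (∃ (Z : Type u) (_ : Group Z), C Z ∧
      Cardinal.mk {x : A ⧸ N // ∃ n : ℕ, x ^ p ^ n = 1} ≤ Cardinal.mk Z)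

/-- `X` is a `𝒞`-bounded nilpotent group: it has a finite central series with
`𝒞`-bounded abelian factors. -/
def CBoundedNilpotent (C : GroupClass.{u}) (X : Type u) [Group X] : Prop :=
  ∃ (n : ℕ) (S : ℕ → Subgroup X), S 0 = ⊥ ∧ S n = ⊤ ∧
    (∀ i < n, S i ≤ S (i + 1)) ∧ (∀ i < n, (S i).Normal) ∧
    (∀ i < n, ∀ x ∈ S (i + 1), ∀ g : X, g⁻¹ * x⁻¹ * g * x ∈ S i) ∧
    (∀ i < n, ∀ _ : ((S i).subgroupOf (S (i + 1))).Normal,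
      CBoundedAbelian C (↥(S (i + 1)) ⧸ (S i).subgroupOf (S (i + 1))))

/-- `A` is a normal subgroup of `U` (as subgroups of a common group). -/
def NormalIn {G : Type u} [Group G] (A U : Subgroup G) : Prop := (A.subgroupOf U).Normal

/-- `G` satisfies a non-trivial identity. -/
def SatisfiesNontrivialIdentity (G : Type u) [Group G] : Prop :=
  ∃ w : FreeGroup ℕ, w ≠ 1 ∧ ∀ f : FreeGroup ℕ →* G, f w = 1

section HNN

variable {B : Type u} [Group B] (H K : Subgroup B) (φ : H ≃* K)

/-- `𝔎 = φ ∘ Aut_B(K) ∘ φ⁻¹`, as a subgroup of `Aut(H)`. -/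
def frakK : Subgroup (MulAut H) := (autOf B K).map (autConjHom φ)

/-- `𝔘 = ⟨𝔥, 𝔎⟩ ≤ Aut(H)`. -/
def frakU : Subgroup (MulAut H) := autOf B H ⊔ frakK H K φ

/-- `𝔙 = ⟨𝔏, 𝔉⟩ ≤ Aut(L)`, where `ψ = φ|_L`. -/
def frakV (ψ : MulAut ↥(H ⊓ K)) : Subgroup (MulAut ↥(H ⊓ K)) :=
  autOf B (H ⊓ K) ⊔ Subgroup.zpowers ψ

/-- `ψ` is the restriction of `φ` to `L = H ⊓ K` (this encodes the
`φ`-invariance of `L` from condition (*)). -/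
def IsRestrictionToL (ψ : MulAut ↥(H ⊓ K)) : Prop :=
  ∀ x : ↥(H ⊓ K), ((ψ x : ↥(H ⊓ K)) : B) = ((φ ⟨(x : B), x.2.1⟩ : K) : B)

/-- `(H ⊓ K)φ = H ⊓ K` : the `φ`-invariance of `L` from condition (*). -/
def PhiInvL : Prop :=
  ((H ⊓ K).subgroupOf H).map φ.toMonoidHom = (H ⊓ K).subgroupOf K

end HNN

section HNNExtra

variable (C : GroupClass.{u}) {B : Type u} [Group B] (H K : Subgroup B) (φ : H ≃* K)

/-- Condition (†): at least one of `𝔥` and `𝔎` is normal in `𝔘`, or `𝔘 ∈ 𝒞`. -/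
def CondDag : Prop :=
  NormalIn (autOf B H) (frakU H K φ) ∨ NormalIn (frakK H K φ) (frakU H K φ) ∨
    C ↥(frakU H K φ)

/-- Condition (‡): at least one of `𝔏` and `𝔉` is normal in `𝔙`, or `𝔙 ∈ 𝒞`. -/
def CondDDag (ψ : MulAut ↥(H ⊓ K)) : Prop :=
  NormalIn (autOf B (H ⊓ K)) (frakV H K ψ) ∨
    NormalIn (Subgroup.zpowers ψ) (frakV H K ψ) ∨ C ↥(frakV H K ψ)

/-- `Q` is a pre-`𝒞`-admissible subgroup of `B`: it is normal, `(H,K,φ)`-compatible,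
`B/Q ∈ 𝒞`, and `HQ/Q ∩ KQ/Q = LQ/Q`. -/
def PreAdmissible (Q : Subgroup B) : Prop :=
  ∃ _ : Q.Normal, ((Q ⊓ H).subgroupOf H).map φ.toMonoidHom = (Q ⊓ K).subgroupOf K ∧
    C (B ⧸ Q) ∧
    (H.map (QuotientGroup.mk' Q)) ⊓ (K.map (QuotientGroup.mk' Q)) =
      (H ⊓ K).map (QuotientGroup.mk' Q)

end HNNExtra

/-- The pairs `(g, α)` such that conjugation by `g` induces `α` on `Y` along `f : Y →* G`. -/
def conjPairs {Y G : Type u} [Group Y] [Group G] (f : Y →* G) : Subgroup (G × MulAut Y) where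
  carrier := { p | ∀ y, f (p.2 y) = p.1 * f y * p.1⁻¹ }
  one_mem' := fun y => by simp
  mul_mem' := by
    intro p q hp hq y
    have h := hp (q.2 y)
    rw [hq y] at h
    simp only [Prod.fst_mul, Prod.snd_mul, MulAut.mul_apply, h]
    group
  inv_mem' := by
    intro p hp y
    have h := hp (p.2⁻¹ y)
    rw [MulAut.apply_inv_self] at h
    simp only [Prod.fst_inv, Prod.snd_inv, h]
    group

theorem mem_conjPairs {Y G : Type u} [Group Y] [Group G] {f : Y →* G} {g : G} {α : MulAut Y} :
    (g, α) ∈ conjPairs f ↔ ∀ y, f (α y) = g * f y * g⁻¹ :=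
  Iff.rfl

section ClosureProperties

variable {C : GroupClass.{u}}

theorem QuotClosed.range (hquot : QuotClosed C) (hiso : IsoClosed C) {X Y : Type u} [Group X]
    [Group Y] (f : X →* Y) (hX : C X) : C f.range :=
  hiso _ _ (QuotientGroup.quotientKerEquivRange f) (hquot X f.ker hX)

theorem SubgroupClosed.of_injective (hsub : SubgroupClosed C) (hiso : IsoClosed C)
    {X Y : Type u} [Group X] [Group Y] (f : X →* Y) (hf : Function.Injective f) (hY : C Y) :
    C X :=
  hiso _ _ (MonoidHom.ofInjective hf).symm (hsub Y f.range hY)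

/-- A group of automorphisms of `Y` induced by conjugations in an overgroup from the class `C`
belongs to `C`. -/
theorem SubgroupClosed.of_le_map_conjPairs (hsub : SubgroupClosed C) (hiso : IsoClosed C)
    (hquot : QuotClosed C) {Y G : Type u} [Group Y] [Group G] {f : Y →* G}
    (hf : Function.Injective f) (hG : C G) {U : Subgroup (MulAut Y)}
    (hU : U ≤ (conjPairs f).map (MonoidHom.snd G (MulAut Y))) : C U := by
  have hP : C (conjPairs f) := by
    refine hsub.of_injective hiso ((MonoidHom.fst G (MulAut Y)).comp (conjPairs f).subtype) ?_ hG
    rintro ⟨⟨g, α⟩, h⟩ ⟨⟨g', β⟩, h'⟩ (rfl : g = g')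
    have hαβ : α = β := MulEquiv.ext fun y => hf ((h y).trans (h' y).symm)
    subst hαβ
    rfl
  have hR : C ((MonoidHom.snd G (MulAut Y)).comp (conjPairs f).subtype).range :=
    hquot.range hiso _ hP
  refine hsub.of_injective hiso (Subgroup.inclusion ?_) (Subgroup.inclusion_injective _) hR
  rwa [MonoidHom.range_comp, Subgroup.range_subtype]

end ClosureProperties

theorem autOf_le_map_conjPairs {X G : Type u} [Group X] [Group G] (Y : Subgroup X) (f : X →* G) :
    autOf X Y ≤ (conjPairs (f.comp Y.subtype)).map (MonoidHom.snd G (MulAut Y)) := by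
  rintro α ⟨x, hx⟩
  refine ⟨(f x, α), mem_conjPairs.2 fun y => ?_, rfl⟩
  simp [hx]

theorem frakK_le_map_conjPairs {B G : Type u} [Group B] [Group G] (H K : Subgroup B) (φ : H ≃* K)
    (σ : HNNExtension B H K φ →* G) :
    frakK H K φ ≤ (conjPairs (σ.comp (HNNExtension.of.comp H.subtype))).map
      (MonoidHom.snd G (MulAut H)) := by
  rintro _ ⟨α, ⟨b, hb⟩, rfl⟩
  refine ⟨(σ (HNNExtension.t⁻¹ * HNNExtension.of b * HNNExtension.t), autConjHom φ α),
    mem_conjPairs.2 fun y => ?_, rfl⟩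
  change σ (HNNExtension.of (φ.symm (α (φ y)) : B)) = _ * σ (HNNExtension.of (y : B)) * _
  simp [HNNExtension.equiv_symm_eq_conj, hb, HNNExtension.equiv_eq_conj, mul_assoc]

theorem statement_9 (C : GroupClass.{u}) (hiso : IsoClosed C)
    (hsub : SubgroupClosed C) (hquot : QuotClosed C)
    {B : Type u} [Group B] (H K : Subgroup B) (φ : H ≃* K)
    (hH : H.Normal) (hK : K.Normal)
    (ψ : MulAut ↥(H ⊓ K)) (hψ : IsRestrictionToL H K φ ψ)
    (G₀ : Type u) [Group G₀] (σ : HNNExtension B H K φ →* G₀)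
    (hσ_onto : Function.Surjective σ) (hσC : C G₀)
    (hσH : Function.Injective (σ.comp (HNNExtension.of.comp H.subtype)))
    (hσK : Function.Injective (σ.comp (HNNExtension.of.comp K.subtype))) :
    C ↥(frakU H K φ) ∧ C ↥(frakV H K ψ) := by
  refine ⟨hsub.of_le_map_conjPairs hiso hquot hσH hσC (sup_le
    (autOf_le_map_conjPairs H (σ.comp HNNExtension.of)) (frakK_le_map_conjPairs H K φ σ)),
    hsub.of_le_map_conjPairs hiso hquot
      (f := (σ.comp HNNExtension.of).comp (H ⊓ K).subtype)
      (fun x y hxy => ?_) hσC (sup_le (autOf_le_map_conjPairs _ _) ?_)⟩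
  · have h := @hσH ⟨x, x.2.1⟩ ⟨y, y.2.1⟩ hxy
    exact Subtype.ext (congrArg (fun z : H => (z : B)) h)
  · rw [Subgroup.zpowers_le]
    refine ⟨(σ HNNExtension.t, ψ), mem_conjPairs.2 fun x => ?_, rfl⟩
    change σ (HNNExtension.of (ψ x : B)) = _ * σ (HNNExtension.of (x : B)) * _
    rw [hψ x, HNNExtension.equiv_eq_conj]
    simp
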